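/- Let $X$ be an unbounded complete hyperbolic space, $z\in X$, $\gamma,\lambda\in(0,1)$, $t_0>0$, $R>0$, and let $f\colon X\to X$ be Lipschitz with $\mathrm{Lip}\,f\le1-\gamma$. Then there exist points $x_0,y_0\in\bar B(z,R+t_0/\gamma)$ with $\rho(x_0,y_0)=t_0$ and a nonexpansive mapping $g\colon X\to X$ such that $g(x)=f(x)$ for all $x\in B(z,R)$, $\rho(g(x),f(x))\le2t_0$ for all $x\in X$, and $\rho(g(x_0),g(y_0))>\lambda t_0$. -/

import Mathlib

/-- A hyperbolic metric space structure: a choice of convex combination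
`W x y l = (1-l) x ⊕ l y` along distinguished geodesic segments. -/
structure HyperbolicW (X : Type*) [MetricSpace X] where
  W : X → X → ℝ → X
  dist_left : ∀ x y : X, ∀ l : ℝ, l ∈ Set.Icc (0:ℝ) 1 →
    dist x (W x y l) = l * dist x y
  dist_right : ∀ x y : X, ∀ l : ℝ, l ∈ Set.Icc (0:ℝ) 1 →
    dist (W x y l) y = (1 - l) * dist x y
  hyp : ∀ x y z : X, ∀ l : ℝ, l ∈ Set.Icc (0:ℝ) 1 →
    dist (W x y l) (W x z l) ≤ l * dist y z
  subseg : ∀ x y : X, ∀ l μ : ℝ, μ ∈ Set.Icc (0:ℝ) 1 → l ∈ Set.Icc (0:ℝ) 1 →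
    μ ≤ l → 0 < l → W x y μ = W x (W x y l) (μ / l)

/-- A mapping is nonexpansive if it is 1-Lipschitz. -/
def Nonexp {X : Type*} [MetricSpace X] (f : X → X) : Prop :=
  ∀ x y : X, dist (f x) (f y) ≤ dist x y

/-- A metric space is unbounded. -/
def Unbdd (X : Type*) [MetricSpace X] : Prop :=
  ¬ Bornology.IsBounded (Set.univ : Set X)

theorem Unbdd.exists_le_dist {X : Type*} [MetricSpace X] (hub : Unbdd X) (p : X) (r : ℝ) :
    ∃ q, r ≤ dist p q := by
  by_contra! h
  refine hub ((Metric.isBounded_closedBall (x := p) (r := r)).subset fun q _ => ?_)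
  rw [Metric.mem_closedBall, dist_comm]
  exact (h q).le

namespace HyperbolicW

variable {X : Type*} [MetricSpace X]

theorem W_one (H : HyperbolicW X) (x y : X) : H.W x y 1 = y := by
  have h := H.dist_right x y 1 ⟨zero_le_one, le_rfl⟩
  rw [sub_self, zero_mul] at h
  exact dist_eq_zero.1 h

theorem exists_dist_eq (H : HyperbolicW X) (hub : Unbdd X) (p : X) {r : ℝ} (hr : 0 < r) :
    ∃ q, dist p q = r := by
  obtain ⟨q, hq⟩ := hub.exists_le_dist p r
  have hpos : 0 < dist p q := hr.trans_le hq
  refine ⟨H.W p q (r / dist p q), ?_⟩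
  rw [H.dist_left p q _ ⟨by positivity, (div_le_one hpos).2 hq⟩, div_mul_cancel₀ _ hpos.ne']

theorem dist_W_W_of_le (H : HyperbolicW X) (x y : X) {l μ : ℝ} (hμ : 0 ≤ μ) (hl : l ≤ 1)
    (h : μ ≤ l) : dist (H.W x y μ) (H.W x y l) = (l - μ) * dist x y := by
  rcases (hμ.trans h).eq_or_lt with h0 | h0
  · have : μ = l := by linarith
    simp [this]
  · rw [H.subseg x y l μ ⟨hμ, h.trans hl⟩ ⟨h0.le, hl⟩ h h0,
      H.dist_right _ _ _ ⟨by positivity, (div_le_one h0).2 h⟩, H.dist_left _ _ _ ⟨h0.le, hl⟩]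
    field_simp

theorem dist_W_W (H : HyperbolicW X) (x y : X) {l μ : ℝ} (hμ : μ ∈ Set.Icc (0 : ℝ) 1)
    (hl : l ∈ Set.Icc (0 : ℝ) 1) : dist (H.W x y μ) (H.W x y l) = |l - μ| * dist x y := by
  rcases le_total μ l with h | h
  · rw [H.dist_W_W_of_le x y hμ.1 hl.2 h, abs_of_nonneg (sub_nonneg.2 h)]
  · rw [dist_comm, H.dist_W_W_of_le x y hl.1 hμ.2 h, abs_sub_comm,
      abs_of_nonneg (sub_nonneg.2 h)]

theorem dist_W_W_le (H : HyperbolicW X) {c x y : X} {α β L : ℝ} (hα : 0 ≤ α) (hβ : β ≤ 1)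
    (hαβ : α ≤ β) (hL : 1 ≤ L)
    (h : β * dist c y - α * dist c x ≤ L * (dist c y - dist c x)) :
    dist (H.W c x α) (H.W c y β) ≤ L * dist x y := by
  have h1 := dist_triangle (H.W c x α) (H.W c y α) (H.W c y β)
  have h2 := H.hyp c x y α ⟨hα, hαβ.trans hβ⟩
  have h3 := H.dist_W_W_of_le c y hα hβ hαβ
  have h4 : 0 ≤ (L - α) * (dist x y - (dist c y - dist c x)) :=
    mul_nonneg (by linarith) (by linarith [dist_triangle c x y])
  linarith

end HyperbolicW

/-- The ratio by which a point at distance `d` from the centre is pulled towards the centre, when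
the ball of radius `t` is collapsed to its centre and the complement of the ball of radius
`t / γ` is fixed. -/
noncomputable def collapseRatio (γ t d : ℝ) : ℝ :=
  min 1 ((1 - t / d) / (1 - γ))

section CollapseRatio

variable {γ t d e : ℝ}

theorem collapseRatio_le_one : collapseRatio γ t d ≤ 1 := min_le_left _ _

theorem collapseRatio_nonneg (hγ : γ < 1) (ht : 0 < t) (hd : t < d) :
    0 ≤ collapseRatio γ t d := by
  have : t / d ≤ 1 := (div_le_one (ht.trans hd)).2 hd.le
  exact le_min zero_le_one (div_nonneg (by linarith) (by linarith))

theorem collapseRatio_mono (hγ : γ < 1) (ht : 0 < t) (hd : t < d) (hde : d ≤ e) :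
    collapseRatio γ t d ≤ collapseRatio γ t e := by
  have hd0 : 0 < d := ht.trans hd
  have hγ' : 0 < 1 - γ := by linarith
  unfold collapseRatio
  gcongr

theorem collapseRatio_eq_one (hγ0 : 0 < γ) (hγ : γ < 1) (ht : 0 < t) (hd : t / γ ≤ d) :
    collapseRatio γ t d = 1 := by
  have hd0 : 0 < d := (div_pos ht hγ0).trans_le hd
  refine min_eq_left ((one_le_div (by linarith)).2 ?_)
  have : t / d ≤ γ := by
    rw [div_le_iff₀ hd0]
    rw [div_le_iff₀ hγ0] at hd
    linarith
  linarith

theorem collapseRatio_mul_le (hγ : γ < 1) (hd : 0 < d) :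
    (1 - γ) * (collapseRatio γ t d * d) ≤ d - t := by
  have hγ' : 0 < 1 - γ := by linarith
  calc (1 - γ) * (collapseRatio γ t d * d)
      ≤ (1 - γ) * (((1 - t / d) / (1 - γ)) * d) := by
        gcongr
        exact min_le_right _ _
    _ = d - t := by field_simp

theorem collapseRatio_eq_one_or (hγ : γ < 1) (hd : 0 < d) :
    collapseRatio γ t d = 1 ∨ (1 - γ) * (collapseRatio γ t d * d) = d - t := by
  have hγ' : 1 - γ ≠ 0 := by linarith
  rcases min_choice 1 ((1 - t / d) / (1 - γ)) with h | h
  · exact Or.inl h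
  · right
    rw [collapseRatio, h]
    field_simp

theorem collapseRatio_mul_sub_le (hγ0 : 0 < γ) (hγ : γ < 1) (hd : 0 < d) (hde : d ≤ e) :
    collapseRatio γ t e * e - collapseRatio γ t d * d ≤ (1 - γ)⁻¹ * (e - d) := by
  have hγ' : 0 < 1 - γ := by linarith
  rw [inv_mul_eq_div, le_div_iff₀ hγ']
  rcases collapseRatio_eq_one_or (t := t) hγ hd with h | h
  · rw [h]
    have h1 : collapseRatio γ t e * e ≤ 1 * e :=
      mul_le_mul_of_nonneg_right collapseRatio_le_one (hd.le.trans hde)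
    nlinarith [mul_nonneg hγ0.le (sub_nonneg.2 hde),
      mul_nonneg hγ'.le (sub_nonneg.2 h1)]
  · linarith [collapseRatio_mul_le (t := t) hγ (hd.trans_le hde)]

end CollapseRatio

section Collapse

variable {X : Type*} [MetricSpace X] (H : HyperbolicW X) {γ t : ℝ} {f : X → X} (c : X)

/-- The radial map towards `c` which collapses the ball of radius `t` and fixes the complement of
the ball of radius `t / γ`; it is only used at points at distance more than `t` from `c`. -/
noncomputable def HyperbolicW.collapse (γ t : ℝ) (x : X) : X :=
  H.W c x (collapseRatio γ t (dist c x))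

theorem HyperbolicW.collapse_of_le (hγ0 : 0 < γ) (hγ : γ < 1) (ht : 0 < t) {x : X}
    (hx : t / γ ≤ dist c x) : H.collapse c γ t x = x := by
  rw [HyperbolicW.collapse, collapseRatio_eq_one hγ0 hγ ht hx, H.W_one]

theorem HyperbolicW.dist_comp_collapse_le (hγ0 : 0 < γ) (hγ : γ < 1) (ht : 0 < t)
    (hf : ∀ x y : X, dist (f x) (f y) ≤ (1 - γ) * dist x y) {x y : X}
    (hx : t < dist c x) (hxy : dist c x ≤ dist c y) :
    dist (f (H.collapse c γ t x)) (f (H.collapse c γ t y)) ≤ dist x y := by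
  have hγ' : 0 < 1 - γ := by linarith
  have h := H.dist_W_W_le (collapseRatio_nonneg hγ ht hx) collapseRatio_le_one
    (collapseRatio_mono hγ ht hx hxy) ((one_le_inv₀ hγ').2 (by linarith))
    (collapseRatio_mul_sub_le hγ0 hγ (ht.trans hx) hxy)
  calc _ ≤ (1 - γ) * dist (H.collapse c γ t x) (H.collapse c γ t y) := hf _ _
    _ ≤ (1 - γ) * ((1 - γ)⁻¹ * dist x y) := by gcongr; exact h
    _ = dist x y := by field_simp

theorem HyperbolicW.dist_comp_collapse_center_le (hγ : γ < 1) (ht : 0 < t)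
    (hf : ∀ x y : X, dist (f x) (f y) ≤ (1 - γ) * dist x y) {x : X} (hx : t < dist c x) :
    dist (f c) (f (H.collapse c γ t x)) ≤ dist c x - t := by
  refine (hf _ _).trans ?_
  rw [HyperbolicW.collapse, H.dist_left _ _ _
    ⟨collapseRatio_nonneg hγ ht hx, collapseRatio_le_one⟩]
  exact collapseRatio_mul_le hγ (ht.trans hx)

theorem HyperbolicW.dist_comp_collapse_self_le (hγ0 : 0 < γ) (hγ : γ < 1) (ht : 0 < t)
    (hf : ∀ x y : X, dist (f x) (f y) ≤ (1 - γ) * dist x y) {x : X} (hx : t < dist c x) :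
    dist (f (H.collapse c γ t x)) (f x) ≤ t := by
  refine (hf _ _).trans ?_
  rw [HyperbolicW.collapse, H.dist_right _ _ _
    ⟨collapseRatio_nonneg hγ ht hx, collapseRatio_le_one⟩]
  rcases collapseRatio_eq_one_or (t := t) hγ (ht.trans hx) with h | h
  · rw [h]
    linarith
  · linarith [mul_pos hγ0 (ht.trans hx)]

/-- The map equal to a bump along the segment from `f c` to `q` on the closed ball of radius `t`
about `c`, and to `f ∘ H.collapse c γ t` outside. -/
noncomputable def HyperbolicW.bumpCollapse (γ t : ℝ) (f : X → X) (q x : X) : X :=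
  if dist c x ≤ t then H.W (f c) q (1 - dist c x / t) else f (H.collapse c γ t x)

variable {c} {q : X}

theorem HyperbolicW.bumpCollapse_of_le {x : X} (hx : dist c x ≤ t) :
    H.bumpCollapse c γ t f q x = H.W (f c) q (1 - dist c x / t) := if_pos hx

theorem HyperbolicW.bumpCollapse_of_lt {x : X} (hx : t < dist c x) :
    H.bumpCollapse c γ t f q x = f (H.collapse c γ t x) := if_neg hx.not_ge

theorem one_sub_dist_div_mem_Icc (ht : 0 < t) {x : X} (hx : dist c x ≤ t) :
    1 - dist c x / t ∈ Set.Icc (0 : ℝ) 1 :=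
  ⟨sub_nonneg.2 ((div_le_one ht).2 hx), sub_le_self _ (by positivity)⟩

theorem HyperbolicW.dist_bumpCollapse_of_le (ht : 0 < t) (hq : dist (f c) q = t) {x : X}
    (hx : dist c x ≤ t) : dist (f c) (H.bumpCollapse c γ t f q x) = t - dist c x := by
  rw [H.bumpCollapse_of_le hx, H.dist_left _ _ _ (one_sub_dist_div_mem_Icc ht hx), hq]
  field_simp

theorem HyperbolicW.nonexp_bumpCollapse (hγ0 : 0 < γ) (hγ : γ < 1) (ht : 0 < t)
    (hf : ∀ x y : X, dist (f x) (f y) ≤ (1 - γ) * dist x y) (hq : dist (f c) q = t) :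
    Nonexp (H.bumpCollapse c γ t f q) := by
  have key : ∀ x y : X, dist c x ≤ dist c y →
      dist (H.bumpCollapse c γ t f q x) (H.bumpCollapse c γ t f q y) ≤ dist x y := by
    intro x y hxy
    have htri := dist_triangle c x y
    rcases le_or_gt (dist c x) t with hx | hx
    · rcases le_or_gt (dist c y) t with hy | hy
      · rw [H.bumpCollapse_of_le hx, H.bumpCollapse_of_le hy, H.dist_W_W _ _
          (one_sub_dist_div_mem_Icc ht hx) (one_sub_dist_div_mem_Icc ht hy), hq,
          sub_sub_sub_cancel_left, ← sub_div, abs_div, abs_of_pos ht, div_mul_cancel₀ _ ht.ne',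
          abs_of_nonpos (sub_nonpos.2 hxy)]
        linarith
      · have h1 := dist_triangle_left (H.bumpCollapse c γ t f q x)
          (H.bumpCollapse c γ t f q y) (f c)
        have h2 := H.dist_bumpCollapse_of_le (γ := γ) ht hq hx
        have h3 := H.dist_comp_collapse_center_le c hγ ht hf hy
        rw [← H.bumpCollapse_of_lt (γ := γ) (f := f) (q := q) hy] at h3
        linarith
    · have hy := hx.trans_le hxy
      rw [H.bumpCollapse_of_lt hx, H.bumpCollapse_of_lt hy]
      exact H.dist_comp_collapse_le c hγ0 hγ ht hf hx hxy
  intro x y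
  rcases le_total (dist c x) (dist c y) with h | h
  · exact key x y h
  · rw [dist_comm, dist_comm x]
    exact key y x h

theorem HyperbolicW.dist_bumpCollapse_self_le (hγ0 : 0 < γ) (hγ : γ < 1) (ht : 0 < t)
    (hf : ∀ x y : X, dist (f x) (f y) ≤ (1 - γ) * dist x y) (hq : dist (f c) q = t) (x : X) :
    dist (H.bumpCollapse c γ t f q x) (f x) ≤ t := by
  rcases le_or_gt (dist c x) t with hx | hx
  · have h1 := dist_triangle_left (H.bumpCollapse c γ t f q x) (f x) (f c)
    have h2 := H.dist_bumpCollapse_of_le (γ := γ) ht hq hx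
    linarith [hf c x, mul_nonneg hγ0.le (dist_nonneg (x := c) (y := x))]
  · rw [H.bumpCollapse_of_lt hx]
    exact H.dist_comp_collapse_self_le c hγ0 hγ ht hf hx

theorem HyperbolicW.bumpCollapse_of_div_lt (hγ0 : 0 < γ) (hγ : γ < 1) (ht : 0 < t) {x : X}
    (hx : t / γ < dist c x) : H.bumpCollapse c γ t f q x = f x := by
  rw [H.bumpCollapse_of_lt ((le_div_self ht.le hγ0 hγ.le).trans_lt hx),
    H.collapse_of_le c hγ0 hγ ht hx.le]

end Collapse

/-- perturbation of a strict contraction into a nonexpansive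
mapping with large modulus of continuity. -/
theorem large_modulus_perturbation {X : Type*} [MetricSpace X] [CompleteSpace X]
    (H : HyperbolicW X) (hub : Unbdd X)
    (z : X) (γ lam : ℝ) (hγ : γ ∈ Set.Ioo (0:ℝ) 1) (hlam : lam ∈ Set.Ioo (0:ℝ) 1)
    (t₀ R : ℝ) (ht₀ : 0 < t₀) (hR : 0 < R)
    (f : X → X) (hf : ∀ x y : X, dist (f x) (f y) ≤ (1 - γ) * dist x y) :
    ∃ x₀ ∈ Metric.closedBall z (R + t₀ / γ), ∃ y₀ ∈ Metric.closedBall z (R + t₀ / γ),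
      dist x₀ y₀ = t₀ ∧
      ∃ g : X → X, Nonexp g ∧
        (∀ x ∈ Metric.ball z R, g x = f x) ∧
        (∀ x : X, dist (g x) (f x) ≤ 2 * t₀) ∧
        lam * t₀ < dist (g x₀) (g y₀) := by
  obtain ⟨hγ0, hγ1⟩ := hγ
  have htγ : t₀ ≤ t₀ / γ := le_div_self ht₀.le hγ0 hγ1.le
  have hD : 0 < R + t₀ / γ := by linarith
  obtain ⟨x₀, hx₀⟩ := H.exists_dist_eq hub z hD
  obtain ⟨q, hq⟩ := H.exists_dist_eq hub (f x₀) ht₀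
  have hl : 1 - t₀ / (R + t₀ / γ) ∈ Set.Icc (0 : ℝ) 1 :=
    ⟨sub_nonneg.2 ((div_le_one hD).2 (by linarith)), sub_le_self _ (by positivity)⟩
  set y₀ := H.W z x₀ (1 - t₀ / (R + t₀ / γ))
  have hzy : dist z y₀ ≤ R + t₀ / γ := by
    rw [H.dist_left _ _ _ hl, hx₀]
    exact mul_le_of_le_one_left hD.le hl.2
  have hxy : dist x₀ y₀ = t₀ := by
    rw [dist_comm, H.dist_right _ _ _ hl, hx₀, sub_sub_cancel, div_mul_cancel₀ _ hD.ne']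
  refine ⟨x₀, by rw [Metric.mem_closedBall, dist_comm, hx₀], y₀,
    by rwa [Metric.mem_closedBall, dist_comm], hxy, H.bumpCollapse x₀ γ t₀ f q,
    H.nonexp_bumpCollapse hγ0 hγ1 ht₀ hf hq, fun x hx => ?_, fun x => ?_, ?_⟩
  · apply H.bumpCollapse_of_div_lt hγ0 hγ1 ht₀
    rw [Metric.mem_ball] at hx
    linarith [dist_triangle_left z x₀ x, dist_comm x x₀]
  · linarith [H.dist_bumpCollapse_self_le hγ0 hγ1 ht₀ hf hq x]
  · have h1 := H.dist_bumpCollapse_of_le (γ := γ) ht₀ hq (dist_self x₀ ▸ ht₀.le)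
    have h2 := H.dist_bumpCollapse_of_le (γ := γ) ht₀ hq hxy.le
    rw [hxy, sub_self] at h2
    rw [← dist_eq_zero.1 h2, dist_comm, h1, dist_self, sub_zero]
    exact mul_lt_of_lt_one_left ht₀ hlam.2
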